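/- Let (a_k)_{k≥0} be a real sequence with ∑_{k=0}^∞ |a_k| < ∞ and semi-generating function a(θ) = ∑_{k=0}^∞ a_k e^{ikθ}. Then for every n ≥ 1, the spectral norm (the operator norm induced by the Euclidean norm) of the n×n lower triangular Toeplitz matrix P_{L,n} built from (a_k) is at most max_{θ∈[0,2π)} |a(θ)|; equivalently, ‖P_{L,n} x‖₂ ≤ (max_{θ∈[0,2π)} |a(θ)|)·‖x‖₂ for every vector x ∈ ℝⁿ. -/

import Mathlib

open Real Set

/-- The n×n lower triangular Toeplitz matrix built from a real sequence. -/
def toeplitzL (a : ℕ → ℝ) (n : ℕ) : Matrix (Fin n) (Fin n) ℝ :=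
  Matrix.of fun j k => if (k : ℕ) ≤ (j : ℕ) then a ((j : ℕ) - (k : ℕ)) else 0

open MeasureTheory AddCircle

instance fact_two_pi_pos : Fact (0 < 2 * π) := ⟨Real.two_pi_pos⟩

/-- The `m`-th Fourier coefficient as a continuous linear functional on continuous functions. -/
noncomputable def fourierFunctional (m : ℤ) : C(AddCircle (2 * π), ℂ) →L[ℂ] ℂ :=
  (innerSL ℂ (fourierLp (T := 2 * π) 2 m)).comp
    (ContinuousMap.toLp (E := ℂ) 2 (haarAddCircle (T := 2 * π)) ℂ)

theorem fourierFunctional_fourier (m k : ℤ) :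
    fourierFunctional m (fourier k) = if m = k then 1 else 0 :=
  orthonormal_iff_ite.mp (orthonormal_fourier (T := 2 * π)) m k

theorem summable_smul_fourier {a : ℕ → ℝ} (hsum : Summable fun k => |a k|) :
    Summable fun k : ℕ => (a k : ℂ) • (fourier (k : ℤ) : C(AddCircle (2 * π), ℂ)) := by
  refine Summable.of_norm ?_
  simpa [norm_smul, fourier_norm] using hsum

/-- The trigonometric polynomial with coefficient vector `x`. -/
noncomputable def trigPoly {n : ℕ} (x : Fin n → ℝ) : C(AddCircle (2 * π), ℂ) :=
  ∑ j : Fin n, (x j : ℂ) • fourier (j : ℤ)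

/-- The semi-generating function as a continuous function on the circle. -/
noncomputable def semiGen (a : ℕ → ℝ) : C(AddCircle (2 * π), ℂ) :=
  ∑' k : ℕ, (a k : ℂ) • fourier (k : ℤ)

theorem semiGen_coe {a : ℕ → ℝ} (hsum : Summable fun k => |a k|) (θ : ℝ) :
    semiGen a (θ : AddCircle (2 * π)) =
      ∑' k : ℕ, (a k : ℂ) * Complex.exp (Complex.I * k * θ) := by
  rw [semiGen, ← ContinuousMap.tsum_apply (summable_smul_fourier hsum)]
  refine tsum_congr fun k => ?_
  have hπ : (π : ℂ) ≠ 0 := by exact_mod_cast Real.pi_ne_zero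
  rw [ContinuousMap.smul_apply, fourier_coe_apply, smul_eq_mul]
  congr 2
  push_cast
  field_simp

theorem norm_semiGen_le {a : ℕ → ℝ} (hsum : Summable fun k => |a k|)
    (t : AddCircle (2 * π)) :
    ‖semiGen a t‖ ≤
      sSup ((fun θ : ℝ => ‖∑' k : ℕ, (a k : ℂ) * Complex.exp (Complex.I * k * θ)‖) ''
          Set.Ico (0:ℝ) (2*π)) := by
  refine le_csSup ⟨‖semiGen a‖, ?_⟩ ?_
  · rintro _ ⟨θ, -, rfl⟩
    simpa only [semiGen_coe hsum] using (semiGen a).norm_coe_le_norm (θ : AddCircle (2 * π))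
  · obtain ⟨θ, hθ, rfl⟩ : ∃ θ ∈ Set.Ico (0 : ℝ) (2 * π), (θ : AddCircle (2 * π)) = t := by
      have h := AddCircle.coe_image_Ico_eq (2 * π) 0
      rw [zero_add] at h
      have ht : t ∈ ((↑) : ℝ → AddCircle (2 * π)) '' Set.Ico 0 (2 * π) := h ▸ Set.mem_univ t
      exact ht
    exact ⟨θ, hθ, by simp only [semiGen_coe hsum]⟩

theorem fourierFunctional_semiGen_mul_trigPoly {a : ℕ → ℝ} (hsum : Summable fun k => |a k|)
    {n : ℕ} (x : Fin n → ℝ) (m : Fin n) :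
    fourierFunctional (m : ℤ) (semiGen a * trigPoly x) = ((toeplitzL a n).mulVec x m : ℝ) := by
  have hterm (j : Fin n) : HasSum
      (fun k : ℕ => fourierFunctional (m : ℤ) (((a k : ℂ) • fourier (k : ℤ)) * fourier (j : ℤ)))
      (fourierFunctional (m : ℤ) (semiGen a * fourier (j : ℤ))) :=
    ((summable_smul_fourier hsum).hasSum.mul_right _).mapL _
  have hval (j : Fin n) : fourierFunctional (m : ℤ) (semiGen a * fourier (j : ℤ)) =
      (toeplitzL a n m j : ℂ) := by
    refine (hterm j).unique ?_
    have hk (k : ℕ) : fourierFunctional (m : ℤ)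
        (((a k : ℂ) • fourier (k : ℤ)) * fourier (j : ℤ)) =
        if (m : ℕ) = k + j then (a k : ℂ) else 0 := by
      have hmul : (fourier (k : ℤ) : C(AddCircle (2 * π), ℂ)) * fourier (j : ℤ) =
          fourier ((k : ℤ) + (j : ℤ)) := by
        ext t
        exact fourier_add.symm
      rw [smul_mul_assoc, hmul, map_smul, fourierFunctional_fourier]
      norm_cast
      simp
    simp only [hk, toeplitzL, Matrix.of_apply]
    split_ifs with h
    · convert hasSum_ite_eq ((m : ℕ) - (j : ℕ)) (a ((m : ℕ) - (j : ℕ)) : ℂ) using 2 with k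
      have : (m : ℕ) = k + j ↔ k = (m : ℕ) - (j : ℕ) := by omega
      simp only [this]
      split_ifs with hkm
      · rw [hkm]
      · rfl
    · convert hasSum_zero using 2 with k
      · exact if_neg (by omega)
      · simp
  simp only [trigPoly, Finset.mul_sum, map_sum, mul_smul_comm, map_smul, hval, Matrix.mulVec,
    dotProduct, smul_eq_mul]
  push_cast
  exact Finset.sum_congr rfl fun j _ => mul_comm _ _

theorem norm_toLp_trigPoly {n : ℕ} (x : Fin n → ℝ) :
    ‖ContinuousMap.toLp (E := ℂ) 2 (haarAddCircle (T := 2 * π)) ℂ (trigPoly x)‖ =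
      Real.sqrt (∑ i : Fin n, (x i) ^ 2) := by
  have ho : Orthonormal ℂ fun j : Fin n => fourierLp (T := 2 * π) 2 (j : ℤ) :=
    (orthonormal_fourier (T := 2 * π)).comp _ fun i j h => Fin.ext (by simpa using h)
  have hX : ContinuousMap.toLp (E := ℂ) 2 (haarAddCircle (T := 2 * π)) ℂ (trigPoly x) =
      ∑ j : Fin n, (x j : ℂ) • fourierLp (T := 2 * π) 2 (j : ℤ) := by
    simp only [trigPoly, map_sum, map_smul]
  rw [hX, @norm_eq_sqrt_re_inner ℂ, ho.inner_sum]
  congr 1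
  simp [pow_two]

theorem norm_toLp_mul_le {f g : C(AddCircle (2 * π), ℂ)} {M : ℝ} (hf : ∀ t, ‖f t‖ ≤ M) :
    ‖ContinuousMap.toLp (E := ℂ) 2 (haarAddCircle (T := 2 * π)) ℂ (f * g)‖ ≤
      M * ‖ContinuousMap.toLp (E := ℂ) 2 (haarAddCircle (T := 2 * π)) ℂ g‖ := by
  refine Lp.norm_le_mul_norm_of_ae_le_mul ?_
  filter_upwards [ContinuousMap.coeFn_toLp (E := ℂ) (p := 2) (𝕜 := ℂ) haarAddCircle (f * g),
    ContinuousMap.coeFn_toLp (E := ℂ) (p := 2) (𝕜 := ℂ) haarAddCircle g] with t h₁ h₂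
  rw [h₁, h₂, ContinuousMap.mul_apply, norm_mul]
  exact mul_le_mul_of_nonneg_right (hf t) (norm_nonneg _)

theorem sqrt_sum_fourierFunctional_le (g : C(AddCircle (2 * π), ℂ)) (n : ℕ) :
    Real.sqrt (∑ i : Fin n, ‖fourierFunctional (i : ℤ) g‖ ^ 2) ≤
      ‖ContinuousMap.toLp (E := ℂ) 2 (haarAddCircle (T := 2 * π)) ℂ g‖ := by
  have ho : Orthonormal ℂ fun j : Fin n => fourierLp (T := 2 * π) 2 (j : ℤ) :=
    (orthonormal_fourier (T := 2 * π)).comp _ fun i j h => Fin.ext (by simpa using h)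
  exact Real.sqrt_le_iff.mpr ⟨norm_nonneg _, ho.sum_inner_products_le _⟩

/-- the spectral (Euclidean operator) norm of the lower
triangular Toeplitz matrix is bounded by the maximum modulus of the
semi-generating function on the unit circle. -/
theorem stmt3 (a : ℕ → ℝ) (hsum : Summable fun k => |a k|)
    (n : ℕ) (hn : 1 ≤ n) (x : Fin n → ℝ) :
    Real.sqrt (∑ i : Fin n, ((toeplitzL a n).mulVec x i) ^ 2) ≤
      sSup ((fun θ : ℝ => ‖∑' k : ℕ, (a k : ℂ) * Complex.exp (Complex.I * k * θ)‖) ''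
          Set.Ico (0:ℝ) (2*π)) *
        Real.sqrt (∑ i : Fin n, (x i) ^ 2) := by
  have hbessel := sqrt_sum_fourierFunctional_le (semiGen a * trigPoly x) n
  simp only [fourierFunctional_semiGen_mul_trigPoly hsum, Complex.norm_real, Real.norm_eq_abs,
    sq_abs] at hbessel
  rw [← norm_toLp_trigPoly x]
  exact hbessel.trans (norm_toLp_mul_le (norm_semiGen_le hsum))
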